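/- Let K be an imaginary quadratic field, O an order in K of discriminant D_O, and N a positive integer. For a form Q = ax² + bxy + cy² ∈ Q(D_O), the fractional O-ideal ℤω_Q + ℤ belongs to I(O, N) if and only if gcd(a, N) = 1 (i.e., if and only if Q ∈ Q(D_O, N)). -/

import Mathlib

open scoped nonZeroDivisors

set_option synthInstance.maxHeartbeats 1000000
set_option maxHeartbeats 1000000

noncomputable section

/-- `√D := i√|D|` for a negative integer `D`. -/
def sqrtD (D : ℤ) : ℂ := Complex.I * Real.sqrt (Int.natAbs D)

/-- `τ_O`: `√D/2` if `D ≡ 0 (mod 4)`, and `(-1+√D)/2` if `D ≡ 1 (mod 4)`. -/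
def tauD (D : ℤ) : ℂ := if D % 4 = 0 then sqrtD D / 2 else (-1 + sqrtD D) / 2

/-- The order `O = ℤτ_O + ℤ = ℤ[τ_O]` of discriminant `D` in the imaginary quadratic field
`K = ℚ(√D) ⊆ ℂ`. -/
def OD (D : ℤ) : Subalgebra ℤ ℂ := Algebra.adjoin ℤ {tauD D}

/-- Fractional `O`-ideals (inside `ℂ ⊇ K`; every fractional `O`-ideal lies in `K`). -/
abbrev Frac (O : Subalgebra ℤ ℂ) := FractionalIdeal ((O : Type))⁰ ℂ

/-- A nonzero ideal `a` of `O` is *prime to* `m` if `a + mO = O`. -/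
def primeTo (O : Subalgebra ℤ ℂ) (m : ℕ) (a : Ideal O) : Prop :=
  a ⊔ Ideal.span {(m : (O : Type))} = ⊤

/-- `M(O, m)`: the nonzero proper (equivalently, invertible) `O`-ideals prime to `m`. -/
def Mset (O : Subalgebra ℤ ℂ) (m : ℕ) : Set (Ideal O) :=
  {a | a ≠ 0 ∧ primeTo O m a ∧ IsUnit (a : Frac O)}

/-- `I(O, m)`: the subgroup of invertible fractional `O`-ideals generated by `M(O, m)`. -/
def Igrp (O : Subalgebra ℤ ℂ) (m : ℕ) : Subgroup (Frac O)ˣ :=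
  Subgroup.closure {u | ∃ a ∈ Mset O m, (u : Frac O) = a}

/-- `P_N(O)`: the subgroup generated by the principal ideals `νO` with `ν ∈ O` nonzero and
`ν ≡ 1 (mod NO)`. -/
def Pgrp (O : Subalgebra ℤ ℂ) (N : ℕ) : Subgroup (Frac O)ˣ :=
  Subgroup.closure {u | ∃ ν : (O : Type), ν ≠ 0 ∧
    (∃ μ : (O : Type), ν = 1 + (N : (O : Type)) * μ) ∧
    (u : Frac O) = ((Ideal.span {ν} : Ideal O) : Frac O)}

/-- The ray class group `C_N(O) = I(O, N)/P_N(O)`. -/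
abbrev ClsGrp (O : Subalgebra ℤ ℂ) (N : ℕ) :=
  (Igrp O N) ⧸ ((Pgrp O N).subgroupOf (Igrp O N))

/-- The underlying set (in `ℂ`) of an invertible fractional ideal. -/
def fracSet {O : Subalgebra ℤ ℂ} (u : (Frac O)ˣ) : Set ℂ :=
  (((u : Frac O) : Submodule (O : Type) ℂ) : Set ℂ)

/-- An integral binary quadratic form `a x² + b x y + c y²`. -/
structure QF where
  a : ℤ
  b : ℤ
  c : ℤ

/-- The discriminant `b² - 4ac`. -/
def QF.disc (Q : QF) : ℤ := Q.b ^ 2 - 4 * Q.a * Q.c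

/-- `Q ∈ 𝒬(D)`: primitive positive definite of discriminant `D`. -/
def IsForm (D : ℤ) (Q : QF) : Prop :=
  Int.gcd Q.a (Int.gcd Q.b Q.c) = 1 ∧ Q.disc = D ∧ 0 < Q.a

/-- `Q ∈ 𝒬(D, N)`: additionally `gcd(a, N) = 1`. -/
def IsFormN (D : ℤ) (N : ℕ) (Q : QF) : Prop := IsForm D Q ∧ Int.gcd Q.a N = 1

/-- `ω_Q = (-b + √D)/(2a)`, the root of `Q(x, 1)` in the upper half-plane. -/
def omegaQ (D : ℤ) (Q : QF) : ℂ := (-(Q.b : ℂ) + sqrtD D) / (2 * Q.a)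

/-- The lattice `ℤω + ℤ`, as a subset of `ℂ`. -/
def latticeSet (ω : ℂ) : Set ℂ := {z : ℂ | ∃ m n : ℤ, z = (m : ℂ) * ω + (n : ℂ)}

theorem sqrtD_sq (D : ℤ) (hD : D < 0) : sqrtD D ^ 2 = (D : ℂ) := by
  unfold sqrtD
  have h : ((Real.sqrt (Int.natAbs D) : ℝ) : ℂ) ^ 2 = ((Int.natAbs D : ℝ) : ℂ) := by
    rw [← Complex.ofReal_pow, Real.sq_sqrt (by positivity)]
  rw [mul_pow, Complex.I_sq, h]
  have h2 : ((Int.natAbs D : ℤ)) = -D := by omega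
  have h3 : ((Int.natAbs D : ℝ) : ℂ) = (((Int.natAbs D : ℤ)) : ℂ) := by
    rw [Int.cast_natCast, Complex.ofReal_natCast]
  rw [h3, h2]; push_cast; ring

theorem sqrtD_im (D : ℤ) (hD : D < 0) : (sqrtD D).im ≠ 0 := by
  unfold sqrtD
  have : 0 < Real.sqrt (Int.natAbs D) := Real.sqrt_pos.2 (by
    have : 0 < Int.natAbs D := by omega
    exact_mod_cast this)
  simp only [Complex.mul_im, Complex.I_re, Complex.I_im, Complex.ofReal_re, Complex.ofReal_im]
  intro h
  linarith

/-- `aω_Q`. -/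
def thQ (D : ℤ) (Q : QF) : ℂ := (-(Q.b : ℂ) + sqrtD D) / 2

theorem thQ_eq (D : ℤ) (hD : D < 0) (Q : QF) (hQ : IsForm D Q) :
    thQ D Q * thQ D Q = -(Q.b : ℂ) * thQ D Q - Q.a * Q.c := by
  have h := sqrtD_sq D hD
  have h2 : (D : ℂ) = (Q.b : ℂ) ^ 2 - 4 * Q.a * Q.c := by
    rw [← hQ.2.1]; unfold QF.disc; push_cast; ring
  unfold thQ
  linear_combination (1/4 : ℂ) * h + (1/4 : ℂ) * h2

theorem tauD_eq (D : ℤ) (hD4 : D % 4 = 0 ∨ D % 4 = 1) (Q : QF) (hQ : IsForm D Q) :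
    ∃ k : ℤ, tauD D = thQ D Q + k := by
  have h : Q.b ^ 2 - 4 * Q.a * Q.c = D := hQ.2.1
  unfold tauD thQ
  rcases Int.even_or_odd' Q.b with ⟨k, hk | hk⟩
  · have h0 : D % 4 = 0 := by
      rw [← h, hk]
      have : (2 * k) ^ 2 - 4 * Q.a * Q.c = 4 * (k ^ 2 - Q.a * Q.c) := by ring
      omega
    refine ⟨k, ?_⟩
    rw [if_pos h0, hk]; push_cast; ring
  · have h0 : ¬ D % 4 = 0 := by
      rw [← h, hk]
      have : (2 * k + 1) ^ 2 - 4 * Q.a * Q.c = 4 * (k ^ 2 + k - Q.a * Q.c) + 1 := by ring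
      omega
    refine ⟨k, ?_⟩
    rw [if_neg h0, hk]; push_cast; ring

theorem mem_OD (D : ℤ) (hD : D < 0) (hD4 : D % 4 = 0 ∨ D % 4 = 1) (Q : QF) (hQ : IsForm D Q)
    (z : ℂ) : z ∈ OD D ↔ ∃ m n : ℤ, z = (m : ℂ) * thQ D Q + (n : ℂ) := by
  obtain ⟨k, hk⟩ := tauD_eq D hD4 Q hQ
  have ht := thQ_eq D hD Q hQ
  constructor
  · intro hz
    unfold OD at hz
    induction hz using Algebra.adjoin_induction with
    | mem x hx =>
      rw [Set.mem_singleton_iff] at hx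
      exact ⟨1, k, by rw [hx, hk]; push_cast; ring⟩
    | algebraMap r => exact ⟨0, r, by simp⟩
    | add x y _ _ hx hy =>
      obtain ⟨m, n, rfl⟩ := hx
      obtain ⟨m', n', rfl⟩ := hy
      exact ⟨m + m', n + n', by push_cast; ring⟩
    | mul x y _ _ hx hy =>
      obtain ⟨m, n, rfl⟩ := hx
      obtain ⟨m', n', rfl⟩ := hy
      refine ⟨m * n' + n * m' - m * m' * Q.b, n * n' - m * m' * Q.a * Q.c, ?_⟩
      push_cast
      linear_combination (m * m' : ℂ) * ht
  · rintro ⟨m, n, rfl⟩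
    have h1 : tauD D ∈ OD D := Algebra.subset_adjoin rfl
    have h2 : thQ D Q ∈ OD D := by
      have : thQ D Q = tauD D - (k : ℂ) := by rw [hk]; ring
      rw [this]
      exact sub_mem h1 (intCast_mem _ _)
    exact add_mem (mul_mem (intCast_mem _ _) h2) (intCast_mem _ _)

/-- The lattice `ℤα + ℤβ` as a submodule. -/
def latSub (D : ℤ) (α β : ℂ)
    (h : ∀ r ∈ OD D, (∃ m n : ℤ, r * α = m * α + n * β) ∧ (∃ m n : ℤ, r * β = m * α + n * β)) :
    Submodule (OD D) ℂ where
  carrier := {z | ∃ m n : ℤ, z = m * α + n * β}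
  zero_mem' := ⟨0, 0, by simp⟩
  add_mem' := by
    rintro _ _ ⟨m, n, rfl⟩ ⟨m', n', rfl⟩
    exact ⟨m + m', n + n', by push_cast; ring⟩
  smul_mem' := by
    rintro ⟨r, hr⟩ _ ⟨m, n, rfl⟩
    obtain ⟨⟨p, q, h1⟩, ⟨p', q', h2⟩⟩ := h r hr
    refine ⟨m * p + n * p', m * q + n * q', ?_⟩
    rw [Subalgebra.smul_def, smul_eq_mul]
    push_cast
    linear_combination (m : ℂ) * h1 + (n : ℂ) * h2

theorem mem_latSub (D : ℤ) (α β : ℂ) (h) (z : ℂ) :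
    z ∈ latSub D α β h ↔ ∃ m n : ℤ, z = m * α + n * β := Iff.rfl

theorem isFrac_of (D : ℤ) (I : Submodule (OD D) ℂ) (a : ℤ) (ha : a ≠ 0)
    (h : ∀ z ∈ I, (a : ℂ) * z ∈ OD D) : IsFractional ((OD D : Type))⁰ I := by
  refine ⟨(a : OD D), ?_, ?_⟩
  · rw [mem_nonZeroDivisors_iff_ne_zero]
    exact_mod_cast ha
  · intro z hz
    refine ⟨⟨_, h z hz⟩, ?_⟩
    rw [Subalgebra.smul_def, smul_eq_mul]
    rfl

theorem mem_one_OD (D : ℤ) (z : ℂ) : z ∈ (1 : Frac (OD D)) ↔ z ∈ OD D := by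
  rw [FractionalIdeal.mem_one_iff]
  constructor
  · rintro ⟨x, rfl⟩; exact x.2
  · intro h; exact ⟨⟨z, h⟩, rfl⟩

/-- The unit `aO`. -/
theorem exists_unit_int (D : ℤ) (a : ℤ) (ha : a ≠ 0) :
    ∃ u : (Frac (OD D))ˣ, (u : Frac (OD D)) = ((Ideal.span {(a : OD D)} : Ideal (OD D)) : Frac (OD D)) := by
  have haC : (a : ℂ) ≠ 0 := by exact_mod_cast ha
  have hf : IsFractional ((OD D : Type))⁰ (Submodule.span (OD D) {((a : ℂ))⁻¹}) := by
    refine isFrac_of D _ a ha ?_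
    intro z hz
    obtain ⟨r, rfl⟩ := Submodule.mem_span_singleton.1 hz
    rw [Subalgebra.smul_def, smul_eq_mul]
    have : (a : ℂ) * ((r : ℂ) * (a : ℂ)⁻¹) = r := by field_simp
    rw [this]; exact r.2
  let J : Frac (OD D) := ⟨_, hf⟩
  have hJ : ((Ideal.span {(a : OD D)} : Ideal (OD D)) : Frac (OD D)) * J = 1 := by
    apply le_antisymm
    · rw [FractionalIdeal.mul_le]
      intro x hx z hz
      rw [FractionalIdeal.mem_coeIdeal] at hx
      obtain ⟨x, hx, rfl⟩ := hx
      obtain ⟨y, rfl⟩ := Ideal.mem_span_singleton'.1 hx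
      obtain ⟨r, rfl⟩ := Submodule.mem_span_singleton.1 (show z ∈ Submodule.span (OD D) {((a : ℂ))⁻¹} from hz)
      rw [mem_one_OD, Subalgebra.smul_def, smul_eq_mul]
      have : (algebraMap (OD D) ℂ (y * (a : OD D))) * ((r : ℂ) * (a : ℂ)⁻¹) = (y * r : OD D) := by
        rw [map_mul, map_intCast]
        change (y : ℂ) * a * (r * (a : ℂ)⁻¹) = y * r
        field_simp
      rw [this]; exact (y * r).2
    · rw [FractionalIdeal.one_le]
      have : (1 : ℂ) = (a : ℂ) * (a : ℂ)⁻¹ := by field_simp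
      rw [this]
      refine FractionalIdeal.mul_mem_mul ?_ (Submodule.mem_span_singleton_self _ : _ ∈ Submodule.span (OD D) {((a : ℂ))⁻¹})
      rw [FractionalIdeal.mem_coeIdeal]
      exact ⟨(a : OD D), Ideal.mem_span_singleton_self _, by simp⟩
  exact ⟨⟨_, J, hJ, by rw [mul_comm]; exact hJ⟩, rfl⟩

theorem primeTo_of_mem (D : ℤ) (N : ℕ) (I : Ideal (OD D)) (a : ℤ) (h : Int.gcd a N = 1)
    (ha : (a : OD D) ∈ I) : primeTo (OD D) N I := by
  unfold primeTo
  rw [Ideal.eq_top_iff_one]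
  have hb := Int.gcd_eq_gcd_ab a N
  rw [h] at hb
  have : (1 : OD D) = (Int.gcdA a N : OD D) * a + (Int.gcdB a N : OD D) * (N : OD D) := by
    have := congrArg (fun z : ℤ => (z : OD D)) hb
    push_cast at this
    rw [this]; ring
  rw [this]
  exact Ideal.add_mem _ (Ideal.mem_sup_left (Ideal.mul_mem_left _ _ ha))
    (Ideal.mem_sup_right (Ideal.mul_mem_left _ _ (Ideal.mem_span_singleton_self _)))

theorem exists_int_mem (D : ℤ) (hD : D < 0) (hD4 : D % 4 = 0 ∨ D % 4 = 1) (N : ℕ)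
    (Q : QF) (hQ : IsForm D Q)
    (I : Ideal (OD D)) (h : primeTo (OD D) N I) :
    ∃ n : ℤ, Int.gcd n N = 1 ∧ (n : OD D) ∈ I := by
  unfold primeTo at h
  rw [Ideal.eq_top_iff_one, Submodule.mem_sup] at h
  obtain ⟨β, hβ, y, hy, hs⟩ := h
  obtain ⟨μ, rfl⟩ := Ideal.mem_span_singleton'.1 hy
  obtain ⟨k, m, hμ⟩ := (mem_OD D hD hD4 Q hQ μ).1 μ.2
  have ht := thQ_eq D hD Q hQ
  have hβ2 : (β : ℂ) = 1 - ((k : ℂ) * thQ D Q + m) * N := by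
    have := congrArg (fun z : OD D => (z : ℂ)) hs
    simp only [Subalgebra.coe_add, Subalgebra.coe_mul, Subalgebra.coe_one] at this
    rw [hμ] at this
    have h2 : (((N : OD D)) : ℂ) = (N : ℂ) := rfl
    rw [h2] at this
    linear_combination this
  let n : ℤ := (1 - m * N) ^ 2 + Q.b * (1 - m * N) * (k * N) + Q.a * Q.c * (k * N) ^ 2
  have hconj : (1 - m * N : ℂ) + (k * N) * (Q.b + thQ D Q) ∈ OD D := by
    rw [mem_OD D hD hD4 Q hQ]
    exact ⟨k * N, 1 - m * N + k * N * Q.b, by push_cast; ring⟩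
  refine ⟨n, ?_, ?_⟩
  · rw [← Int.isCoprime_iff_gcd_eq_one]
    refine ⟨1, -(-2 * m + m ^ 2 * N + Q.b * (1 - m * N) * k + Q.a * Q.c * k ^ 2 * N), ?_⟩
    simp only [n]; ring
  · have : (n : OD D) = ⟨_, hconj⟩ * β := by
      apply Subtype.ext
      rw [Subalgebra.coe_mul, hβ2]
      change ((n : OD D) : ℂ) = ((1 - m * N : ℂ) + (k * N) * (Q.b + thQ D Q)) * _
      have h2 : ((n : OD D) : ℂ) = (n : ℂ) := by simp
      rw [h2]
      simp only [n]
      push_cast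
      linear_combination (k * N : ℂ) ^ 2 * ht
    rw [this]
    exact Ideal.mul_mem_left _ _ hβ

theorem Igrp_bound (D : ℤ) (hD : D < 0) (hD4 : D % 4 = 0 ∨ D % 4 = 1) (N : ℕ)
    (Q : QF) (hQ : IsForm D Q) (u : (Frac (OD D))ˣ) (hu : u ∈ Igrp (OD D) N) :
    ∃ n : ℤ, Int.gcd n N = 1 ∧ (∀ x ∈ (u : Frac (OD D)), (n : ℂ) * x ∈ OD D) ∧
      (∀ x ∈ ((u⁻¹ : (Frac (OD D))ˣ) : Frac (OD D)), (n : ℂ) * x ∈ OD D) := by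
  have key : ∀ (I J : Frac (OD D)) (n m : ℤ), (∀ x ∈ I, (n : ℂ) * x ∈ OD D) →
      (∀ x ∈ J, (m : ℂ) * x ∈ OD D) → ∀ x ∈ I * J, ((n * m : ℤ) : ℂ) * x ∈ OD D := by
    intro I J n m hI hJ x hx
    refine FractionalIdeal.mul_induction_on (C := fun x => ((n * m : ℤ) : ℂ) * x ∈ OD D) hx ?_ ?_
    · intro i hi j hj
      have : ((n * m : ℤ) : ℂ) * (i * j) = (n * i) * (m * j) := by push_cast; ring
      rw [this]; exact mul_mem (hI i hi) (hJ j hj)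
    · intro x y hx hy
      rw [mul_add]; exact add_mem hx hy
  unfold Igrp at hu
  induction hu using Subgroup.closure_induction with
  | mem u hu =>
    obtain ⟨I, ⟨_, hp, _⟩, hI⟩ := hu
    obtain ⟨n, hn, hnI⟩ := exists_int_mem D hD hD4 N Q hQ I hp
    refine ⟨n, hn, ?_, ?_⟩
    · intro x hx
      rw [hI, FractionalIdeal.mem_coeIdeal] at hx
      obtain ⟨x, _, rfl⟩ := hx
      exact mul_mem (intCast_mem _ _) x.2
    · intro x hx
      rw [← mem_one_OD, ← Units.mul_inv u]
      refine FractionalIdeal.mul_mem_mul ?_ hx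
      rw [hI, FractionalIdeal.mem_coeIdeal]
      exact ⟨_, hnI, by simp⟩
  | one =>
    refine ⟨1, by simp, ?_, ?_⟩
    · intro x hx
      rw [Units.val_one, mem_one_OD] at hx
      simpa using hx
    · intro x hx
      rw [inv_one, Units.val_one, mem_one_OD] at hx
      simpa using hx
  | mul u v _ _ hu hv =>
    obtain ⟨n, hn, h1, h2⟩ := hu
    obtain ⟨m, hm, h3, h4⟩ := hv
    refine ⟨n * m, ?_, ?_, ?_⟩
    · rw [← Int.isCoprime_iff_gcd_eq_one] at *
      exact hn.mul_left hm
    · rw [Units.val_mul]; exact key _ _ _ _ h1 h3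
    · rw [mul_inv, Units.val_mul]; exact key _ _ _ _ h2 h4
  | inv u _ hu =>
    obtain ⟨n, hn, h1, h2⟩ := hu
    exact ⟨n, hn, h2, by rwa [inv_inv]⟩

theorem forward (D : ℤ) (hD : D < 0) (hD4 : D % 4 = 0 ∨ D % 4 = 1)
    (N : ℕ) (Q : QF) (hQ : IsForm D Q)
    (u : (Frac (OD D))ˣ) (hs : fracSet u = latticeSet (omegaQ D Q)) (hu : u ∈ Igrp (OD D) N) :
      Int.gcd Q.a N = 1 := by
  obtain ⟨n, hn, h1, _⟩ := Igrp_bound D hD hD4 N Q hQ u hu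
  have hω : omegaQ D Q ∈ (u : Frac (OD D)) := by
    have : omegaQ D Q ∈ fracSet u := by rw [hs]; exact ⟨1, 0, by simp⟩
    exact this
  obtain ⟨y, x, hyx⟩ := (mem_OD D hD hD4 Q hQ _).1 (h1 _ hω)
  have ha : (Q.a : ℂ) ≠ 0 := by exact_mod_cast hQ.2.2.ne'
  have h2 : (n : ℂ) * thQ D Q = Q.a * (y * thQ D Q + x) := by
    rw [← hyx]; unfold thQ omegaQ; field_simp
  have him : (thQ D Q).im ≠ 0 := by
    have : (thQ D Q).im = (sqrtD D).im / 2 := by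
      unfold thQ
      have : (-(Q.b : ℂ) + sqrtD D) / 2 = (-(Q.b : ℂ) + sqrtD D) / (2 : ℝ) := by simp
      rw [this, Complex.div_ofReal_im]; simp
    rw [this]
    exact div_ne_zero (sqrtD_im D hD) two_ne_zero
  have h3 : (n : ℝ) = Q.a * y := by
    have := congrArg Complex.im h2
    simp [Complex.mul_im] at this
    apply mul_right_cancel₀ him
    linear_combination this
  have h4 : n = Q.a * y := by exact_mod_cast h3
  rw [← Int.isCoprime_iff_gcd_eq_one] at *
  rw [h4] at hn
  exact hn.of_mul_left_left

theorem backward (D : ℤ) (hD : D < 0) (hD4 : D % 4 = 0 ∨ D % 4 = 1)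
    (N : ℕ) (Q : QF) (hQ : IsForm D Q) (hg : Int.gcd Q.a N = 1) :
    ∃ u : (Frac (OD D))ˣ, fracSet u = latticeSet (omegaQ D Q) ∧ u ∈ Igrp (OD D) N := by
  have haZ : Q.a ≠ 0 := hQ.2.2.ne'
  have ha : (Q.a : ℂ) ≠ 0 := by exact_mod_cast haZ
  have ht := thQ_eq D hD Q hQ
  have hω : thQ D Q = Q.a * omegaQ D Q := by unfold thQ omegaQ; field_simp
  have hmem := mem_OD D hD hD4 Q hQ
  set θ := thQ D Q with hθ
  set ω := omegaQ D Q with hωd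
  have htω : θ * ω = -Q.b * ω - Q.c := by
    apply mul_left_cancel₀ ha
    linear_combination ht - (θ + Q.b) * hω
  have hθO : θ ∈ OD D := (hmem _).2 ⟨1, 0, by simp⟩
  let L := latSub D ω 1 (by
    intro r hr
    obtain ⟨m, n, rfl⟩ := (hmem _).1 hr
    refine ⟨⟨n - m * Q.b, -m * Q.c, ?_⟩, ⟨m * Q.a, n, ?_⟩⟩
    · push_cast; linear_combination (m : ℂ) * htω
    · push_cast; linear_combination (m : ℂ) * hω)
  let J := latSub D (-Q.b - θ) Q.a (by
    intro r hr
    obtain ⟨m, n, rfl⟩ := (hmem _).1 hr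
    refine ⟨⟨n, m * Q.c, ?_⟩, ⟨-m * Q.a, n - m * Q.b, ?_⟩⟩
    · push_cast; linear_combination -(m : ℂ) * ht
    · push_cast; ring)
  have hL : IsFractional ((OD D : Type))⁰ L := by
    refine isFrac_of D _ Q.a haZ ?_
    rintro z ⟨m, n, rfl⟩
    exact (hmem _).2 ⟨m, n * Q.a, by push_cast; linear_combination -(m : ℂ) * hω⟩
  have hJ : IsFractional ((OD D : Type))⁰ J := by
    refine isFrac_of D _ 1 one_ne_zero ?_
    rintro z ⟨m, n, rfl⟩
    exact (hmem _).2 ⟨-m, n * Q.a - m * Q.b, by push_cast; ring⟩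
  let FL : Frac (OD D) := ⟨L, hL⟩
  let FJ : Frac (OD D) := ⟨J, hJ⟩
  have mL : ∀ z, z ∈ FL ↔ ∃ m n : ℤ, z = m * ω + n * 1 := fun z => Iff.rfl
  have mJ : ∀ z, z ∈ FJ ↔ ∃ m n : ℤ, z = m * (-Q.b - θ) + n * Q.a := fun z => Iff.rfl
  have hLJ : FL * FJ = 1 := by
    apply le_antisymm
    · rw [FractionalIdeal.mul_le]
      intro x hx y hy
      obtain ⟨m, n, rfl⟩ := (mL _).1 hx
      obtain ⟨k, l, rfl⟩ := (mJ _).1 hy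
      rw [mem_one_OD, hmem]
      refine ⟨m * l - n * k, m * k * Q.c - n * k * Q.b + n * l * Q.a, ?_⟩
      push_cast
      linear_combination -(m * k : ℂ) * htω - (m * l : ℂ) * hω
    · rw [FractionalIdeal.one_le]
      have e1 : (Q.a : ℂ) ∈ FL * FJ := by
        have := FractionalIdeal.mul_mem_mul ((mL 1).2 ⟨0, 1, by simp⟩) ((mJ Q.a).2 ⟨0, 1, by simp⟩)
        simpa using this
      have e2 : (Q.c : ℂ) ∈ FL * FJ := by
        have := FractionalIdeal.mul_mem_mul ((mL ω).2 ⟨1, 0, by simp⟩)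
          ((mJ (-Q.b - θ)).2 ⟨1, 0, by simp⟩)
        have e : ω * (-Q.b - θ) = Q.c := by linear_combination - htω
        rwa [e] at this
      have e3 : (Q.b : ℂ) ∈ FL * FJ := by
        have h1 := FractionalIdeal.mul_mem_mul ((mL 1).2 ⟨0, 1, by simp⟩)
          ((mJ (-Q.b - θ)).2 ⟨1, 0, by simp⟩)
        have h2 := FractionalIdeal.mul_mem_mul ((mL ω).2 ⟨1, 0, by simp⟩)
          ((mJ Q.a).2 ⟨0, 1, by simp⟩)
        have e : (Q.b : ℂ) = -(1 * (-Q.b - θ) + ω * Q.a) := by linear_combination - hω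
        rw [e]
        exact neg_mem (s := ((FL * FJ : Frac (OD D)) : Submodule (OD D) ℂ)) (add_mem h1 h2)
      have hsm : ∀ (k : ℤ) (z : ℂ), z ∈ FL * FJ → (k : ℂ) * z ∈ FL * FJ := by
        intro k z hz
        rw [← zsmul_eq_mul]
        exact zsmul_mem (S := Submodule (OD D) ℂ) (K := ((FL * FJ : Frac (OD D)) : Submodule (OD D) ℂ)) hz k
      have g1 := Int.gcd_eq_gcd_ab Q.a (Int.gcd Q.b Q.c)
      have g2 := Int.gcd_eq_gcd_ab Q.b Q.c
      rw [hQ.1] at g1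
      have g3 : (1 : ℂ) = (Q.a.gcdA (Q.b.gcd Q.c) : ℤ) * Q.a + ((Q.a.gcdB (Q.b.gcd Q.c) : ℤ) *
          ((Q.b.gcdA Q.c : ℤ) * Q.b + (Q.b.gcdB Q.c : ℤ) * Q.c)) := by
        generalize Q.a.gcdA (Q.b.gcd Q.c) = p at *
        generalize Q.a.gcdB (Q.b.gcd Q.c) = q at *
        rw [g2] at g1
        have := congrArg (fun z : ℤ => (z : ℂ)) g1
        push_cast at this
        linear_combination this
      rw [g3]
      exact add_mem (S := Submodule (OD D) ℂ) (s := ((FL * FJ : Frac (OD D)) : Submodule (OD D) ℂ)) (hsm _ _ e1) (hsm _ _ (add_mem (S := Submodule (OD D) ℂ) (s := ((FL * FJ : Frac (OD D)) : Submodule (OD D) ℂ)) (hsm _ _ e3) (hsm _ _ e2)))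
  let u : (Frac (OD D))ˣ := ⟨FL, FJ, hLJ, by rw [mul_comm]; exact hLJ⟩
  refine ⟨u, ?_, ?_⟩
  · ext z
    change z ∈ FL ↔ _
    rw [mL]
    simp only [mul_one]
    rfl
  obtain ⟨v, hv⟩ := exists_unit_int D Q.a haZ
  have haO : (Q.a : OD D) ≠ 0 := by exact_mod_cast haZ
  have hvI : v ∈ Igrp (OD D) N := by
    refine Subgroup.subset_closure ⟨_, ⟨?_, ?_, ?_⟩, hv⟩
    · intro h
      exact haO (by simpa using h)
    · exact primeTo_of_mem D N _ Q.a hg (Ideal.mem_span_singleton_self _)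
    · rw [← hv]; exact v.isUnit
  have hav : (Q.a : ℂ) ∈ (v : Frac (OD D)) := by
    rw [hv, FractionalIdeal.mem_coeIdeal]
    exact ⟨_, Ideal.mem_span_singleton_self _, by simp⟩
  have huv : u * v ∈ Igrp (OD D) N := by
    have hle : ((u * v : (Frac (OD D))ˣ) : Frac (OD D)) ≤ 1 := by
      rw [Units.val_mul, FractionalIdeal.mul_le]
      intro x hx y hy
      obtain ⟨m, n, rfl⟩ := (mL _).1 hx
      rw [hv, FractionalIdeal.mem_coeIdeal] at hy
      obtain ⟨y, hy, rfl⟩ := hy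
      obtain ⟨r, rfl⟩ := Ideal.mem_span_singleton'.1 hy
      rw [mem_one_OD, map_mul, map_intCast]
      have : ((m : ℂ) * ω + n * 1) * (algebraMap (OD D) ℂ r * Q.a) = (m * θ + (n * Q.a : ℤ)) * (r : ℂ) := by
        change ((m : ℂ) * ω + n * 1) * ((r : ℂ) * Q.a) = (m * θ + (n * Q.a : ℤ)) * (r : ℂ)
        push_cast
        linear_combination - (m * r : ℂ) * hω
      rw [this]
      exact mul_mem ((hmem _).2 ⟨m, n * Q.a, rfl⟩) r.2
    obtain ⟨I, hI⟩ := FractionalIdeal.le_one_iff_exists_coeIdeal.1 hle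
    have haI : (Q.a : OD D) ∈ I := by
      have h1 : (Q.a : ℂ) ∈ ((u * v : (Frac (OD D))ˣ) : Frac (OD D)) := by
        rw [Units.val_mul]
        have := FractionalIdeal.mul_mem_mul ((mL 1).2 ⟨0, 1, by simp⟩) hav
        rw [one_mul] at this
        exact this
      rw [← hI, FractionalIdeal.mem_coeIdeal] at h1
      obtain ⟨x, hx, hxa⟩ := h1
      have : x = (Q.a : OD D) := by
        apply Subtype.ext
        change algebraMap (OD D) ℂ x = _
        rw [hxa]; simp
      rwa [← this]
    refine Subgroup.subset_closure ⟨I, ⟨?_, ?_, ?_⟩, hI.symm⟩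
    · rintro rfl
      exact haO (by simpa using haI)
    · exact primeTo_of_mem D N _ Q.a hg haI
    · rw [hI]; exact (u * v).isUnit
  have : u = u * v * v⁻¹ := by simp
  rw [this]
  exact mul_mem huv (inv_mem hvI)

/-!
STATEMENT 11: for a form `Q = ax² + bxy + cy² ∈ 𝒬(D_O)`, the fractional `O`-ideal
`ℤω_Q + ℤ` belongs to `I(O, N)` if and only if `gcd(a, N) = 1`, i.e. iff `Q ∈ 𝒬(D_O, N)`.
(Here "the fractional ideal `ℤω_Q + ℤ` belongs to `I(O, N)`" is expressed as: some
invertible fractional ideal with underlying set `ℤω_Q + ℤ` lies in the subgroup `I(O, N)`.)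
-/

theorem statement11 (D : ℤ) (hD : D < 0) (hD4 : D % 4 = 0 ∨ D % 4 = 1)
    (N : ℕ) (hN : 0 < N) (Q : QF) (hQ : IsForm D Q) :
    (∃ u : (Frac (OD D))ˣ, fracSet u = latticeSet (omegaQ D Q) ∧ u ∈ Igrp (OD D) N) ↔
      Int.gcd Q.a N = 1 := by
  exact ⟨fun ⟨u, h1, h2⟩ => forward D hD hD4 N Q hQ u h1 h2, backward D hD hD4 N Q hQ⟩
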